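/- arXiv:2309.03197 — 2 statements merged into one kernel-verified Lean document; each statement's English description precedes it below -/
import Mathlib

section
/- Let μ and ν be centered (mean-zero) log-concave probability measures on ℤ each having first absolute moment at most 1 (i.e., Σ_{k∈ℤ} |k|·μ({k}) ≤ 1 and Σ_{k∈ℤ} |k|·ν({k}) ≤ 1). Then for all 1 ≤ p ≤ q, W_q^q(μ, ν) ≤ 24^{q−p}·W_p^p(μ, ν)·log^{q−p}( 6^q·√Γ(2q + 1) / W_p^p(μ, ν) ) + 2·W_p^p(μ, ν). -/
open MeasureTheory ProbabilityTheory
open scoped ProbabilityTheory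

/-- A function `p : ℤ → ℝ` is a log-concave probability mass function if
`p(k)² ≥ p(k-1)·p(k+1)` for all `k ∈ ℤ` and its support is an integer interval. -/
def IsLogConcavePMF (p : ℤ → ℝ) : Prop :=
  (∀ k : ℤ, p (k - 1) * p (k + 1) ≤ p k ^ 2) ∧
  (∀ a b c : ℤ, a ≤ b → b ≤ c → 0 < p a → 0 < p c → 0 < p b)

/-- `W_r^r(μ,ν) = inf E[|X − Y|^r]`, the `r`-th power of the `r`-th Wasserstein
distance, the infimum running over all couplings of `μ` and `ν`. -/
noncomputable def WassersteinPow (r : ℝ) (μ ν : Measure ℤ) : ℝ :=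
  (⨅ π ∈ {π : Measure (ℤ × ℤ) | π.map Prod.fst = μ ∧ π.map Prod.snd = ν},
    ∫⁻ x, ENNReal.ofReal (|(x.1 : ℝ) - (x.2 : ℝ)| ^ r) ∂π).toReal


structure LCN (f : ℕ → ℝ) : Prop where
  nn : ∀ n, 0 ≤ f n
  lc : ∀ n, f n * f (n + 2) ≤ f (n + 1) ^ 2
  iv : ∀ a b c, a ≤ b → b ≤ c → 0 < f a → 0 < f c → 0 < f b

theorem LCN.a1 {f : ℕ → ℝ} (h : LCN f) (m d : ℕ) :
    f m * f (m + d + 1) ≤ f (m + 1) * f (m + d) := by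
  induction d with
  | zero => simp [mul_comm]
  | succ d ih =>
    rcases (h.nn m).eq_or_lt with h0 | h0
    · rw [← h0, zero_mul]; exact mul_nonneg (h.nn _) (h.nn _)
    rcases (h.nn (m + (d + 1) + 1)).eq_or_lt with h1 | h1
    · rw [← h1, mul_zero]; exact mul_nonneg (h.nn _) (h.nn _)
    have h2 : 0 < f (m + d) := h.iv m _ _ (by omega) (by omega) h0 h1
    have h3 : 0 < f (m + d + 1) := h.iv m _ _ (by omega) (by omega) h0 h1
    have h4 := h.lc (m + d)
    have e1 : m + (d + 1) + 1 = m + d + 2 := by ring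
    have e2 : m + (d + 1) = m + d + 1 := by ring
    rw [e1] at h1 ⊢
    rw [e2]
    have := mul_le_mul ih h4 (mul_nonneg (h.nn _) (h.nn _)) (mul_nonneg (h.nn _) (h.nn _))
    refine le_of_mul_le_mul_right ?_ (mul_pos h2 h3)
    nlinarith

theorem LCN.a2 {f : ℕ → ℝ} (h : LCN f) (m d j : ℕ) :
    f m * f (m + d + j) ≤ f (m + j) * f (m + d) := by
  induction j with
  | zero => simp
  | succ j ih =>
    rcases (h.nn m).eq_or_lt with h0 | h0
    · rw [← h0, zero_mul]; exact mul_nonneg (h.nn _) (h.nn _)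
    rcases (h.nn (m + d + (j + 1))).eq_or_lt with h1 | h1
    · rw [← h1, mul_zero]; exact mul_nonneg (h.nn _) (h.nn _)
    have h2 : 0 < f (m + d + j) := h.iv m _ _ (by omega) (by omega) h0 h1
    have h3 : 0 < f (m + j) := h.iv m _ _ (by omega) (by omega) h0 h1
    have h4 := h.a1 (m + j) d
    have e1 : m + j + d + 1 = m + d + (j + 1) := by ring
    have e2 : m + j + d = m + d + j := by ring
    have e3 : m + j + 1 = m + (j + 1) := by ring
    rw [e1, e2, e3] at h4
    have := mul_le_mul ih h4 (mul_nonneg (h.nn _) (h.nn _)) (mul_nonneg (h.nn _) (h.nn _))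
    refine le_of_mul_le_mul_right ?_ (mul_pos h2 h3)
    nlinarith

noncomputable def tl (f : ℕ → ℝ) (n : ℕ) : ℝ := ∑' j, f (n + j)

theorem summ_shift {f : ℕ → ℝ} (hs : Summable f) (n : ℕ) : Summable (fun j => f (n + j)) := by
  have := (summable_nat_add_iff n).2 hs
  simpa [add_comm] using this

theorem tl_succ {f : ℕ → ℝ} (hs : Summable f) (n : ℕ) : tl f n = f n + tl f (n + 1) := by
  unfold tl
  rw [(summ_shift hs n).tsum_eq_zero_add]
  congr 1
  congr 1
  ext j
  congr 1
  ring

theorem tl_anti {f : ℕ → ℝ} (h : ∀ n, 0 ≤ f n) (hs : Summable f) : Antitone (tl f) := by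
  apply antitone_nat_of_succ_le
  intro n
  rw [tl_succ hs n]
  linarith [h n]

theorem tl_nonneg {f : ℕ → ℝ} (h : ∀ n, 0 ≤ f n) (n : ℕ) : 0 ≤ tl f n :=
  tsum_nonneg fun _ => h _

theorem LCN.tail {f : ℕ → ℝ} (h : LCN f) (hs : Summable f) : LCN (tl f) := by
  refine ⟨tl_nonneg h.nn, ?_, ?_⟩
  · intro n
    have key : f n * tl f (n + 2) ≤ f (n + 1) * tl f (n + 1) := by
      unfold tl
      rw [← tsum_mul_left, ← tsum_mul_left]
      refine Summable.tsum_le_tsum ?_ ((summ_shift hs _).mul_left _) ((summ_shift hs _).mul_left _)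
      intro j
      have := h.a2 n 1 (1 + j)
      have e1 : n + 1 + (1 + j) = n + 2 + j := by ring
      have e2 : n + (1 + j) = n + 1 + j := by ring
      rw [e1, e2] at this
      linarith
    have e1 := tl_succ hs n
    have e2 := tl_succ hs (n + 1)
    have e3 : n + 1 + 1 = n + 2 := by ring
    rw [e3] at e2
    have : tl f n * tl f (n + 2) = f n * tl f (n + 2) + tl f (n + 1) * tl f (n + 2) := by
      rw [e1]; ring
    rw [this]
    have : tl f (n + 1) ^ 2 = f (n + 1) * tl f (n + 1) + tl f (n + 1) * tl f (n + 2) := by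
      rw [e2]; ring
    rw [this]
    linarith
  · intro a b c _ hbc _ hc
    exact hc.trans_le (tl_anti h.nn hs hbc)

theorem tl_tendsto {f : ℕ → ℝ} : Filter.Tendsto (tl f) Filter.atTop (nhds 0) := by
  have := tendsto_sum_nat_add f
  refine this.congr fun n => ?_
  simp only [tl, add_comm]

theorem LCN.tail_summable {f : ℕ → ℝ} (h : LCN f) (hs : Summable f) : Summable (tl f) := by
  have hT := h.tail hs
  by_cases hx : ∃ n, tl f (n + 1) < tl f n
  · obtain ⟨n, hn⟩ := hx
    have hp : 0 < tl f n := (hT.nn _).trans_lt hn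
    refine summable_of_ratio_norm_eventually_le (r := tl f (n + 1) / tl f n)
      ((div_lt_one hp).2 hn) ?_
    filter_upwards [Filter.eventually_ge_atTop n] with k hk
    obtain ⟨d, rfl⟩ := Nat.exists_eq_add_of_le hk
    rw [Real.norm_of_nonneg (hT.nn _), Real.norm_of_nonneg (hT.nn _), div_mul_eq_mul_div,
      le_div_iff₀ hp]
    have := hT.a1 n d
    linarith
  · push Not at hx
    have hm : Monotone (tl f) := monotone_nat_of_le_succ hx
    have h0 : ∀ n, tl f n = 0 := fun n =>
      le_antisymm (hm.ge_of_tendsto tl_tendsto n) (hT.nn n)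
    have : tl f = fun _ => 0 := funext h0
    rw [this]
    exact summable_zero

theorem abel {f : ℕ → ℝ} (hs : Summable f) (φ : ℕ → ℝ) (h0 : φ 0 = 0) (N : ℕ) :
    ∑ k ∈ Finset.range (N + 1), φ k * f k + φ N * tl f (N + 1) =
      ∑ k ∈ Finset.range N, (φ (k + 1) - φ k) * tl f (k + 1) := by
  induction N with
  | zero => simp [h0]
  | succ N ih =>
    rw [Finset.sum_range_succ, Finset.sum_range_succ (fun k => (φ (k + 1) - φ k) * tl f (k + 1)), ← ih]
    have := tl_succ hs (N + 1)
    rw [this]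
    ring

theorem summ_partial {g : ℕ → ℝ} {C : ℝ} (h : ∀ n, 0 ≤ g n)
    (hb : ∀ N, ∑ k ∈ Finset.range (N + 1), g k ≤ C) : Summable g ∧ ∑' n, g n ≤ C := by
  have hb' : ∀ N, ∑ k ∈ Finset.range N, g k ≤ C := fun N =>
    (Finset.sum_le_sum_of_subset_of_nonneg (Finset.range_mono (Nat.le_succ N))
      (fun _ _ _ => h _)).trans (hb N)
  exact ⟨summable_of_sum_range_le h hb', Real.tsum_le_of_sum_range_le h hb'⟩

theorem LCN.moment_summable {f : ℕ → ℝ} (h : LCN f) (hs : Summable f) :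
    Summable (fun k : ℕ => (k : ℝ) * f k) := by
  refine (summ_partial (C := tl (tl f) 1) (fun n => mul_nonneg n.cast_nonneg (h.nn n)) ?_).1
  intro N
  have h1 := abel hs (fun k => (k : ℝ)) (by simp) N
  have h2 : 0 ≤ (N : ℝ) * tl f (N + 1) := mul_nonneg N.cast_nonneg (tl_nonneg h.nn _)
  have h3 : ∑ k ∈ Finset.range N, tl f (1 + k) ≤ tl (tl f) 1 :=
    (summ_shift (h.tail_summable hs) 1).sum_le_tsum _ (fun _ _ => tl_nonneg h.nn _)
  have h4 : ∑ k ∈ Finset.range N, (((k + 1 : ℕ) : ℝ) - (k : ℝ)) * tl f (k + 1)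
      = ∑ k ∈ Finset.range N, tl f (1 + k) :=
    Finset.sum_congr rfl fun k _ => by push_cast; rw [add_comm k 1]; ring
  rw [h4] at h1
  linarith

theorem LCN.S1 {f : ℕ → ℝ} (h : LCN f) (hs : Summable f) :
    tl (tl f) 1 ≤ ∑' k : ℕ, (k : ℝ) * f k := by
  have hm := h.moment_summable hs
  refine Real.tsum_le_of_sum_range_le (fun _ => tl_nonneg h.nn _) ?_
  intro N
  have h1 := abel hs (fun k => (k : ℝ)) (by simp) N
  have h4 : ∑ k ∈ Finset.range N, (((k + 1 : ℕ) : ℝ) - (k : ℝ)) * tl f (k + 1)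
      = ∑ k ∈ Finset.range N, tl f (1 + k) :=
    Finset.sum_congr rfl fun k _ => by push_cast; rw [add_comm k 1]; ring
  rw [h4] at h1
  rw [← h1, ← hm.sum_add_tsum_nat_add (N + 1)]
  gcongr
  unfold tl
  rw [← tsum_mul_left]
  refine Summable.tsum_le_tsum ?_ ((summ_shift hs _).mul_left _) ((summable_nat_add_iff _).2 hm)
  intro j
  rw [add_comm j]
  refine mul_le_mul_of_nonneg_right ?_ (h.nn _)
  push_cast
  linarith [j.cast_nonneg (α := ℝ)]

theorem exp_quarter : Real.exp (1 / 4) ≤ 4 / 3 := by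
  have := Real.one_sub_le_exp_neg (1 / 4)
  rw [Real.exp_neg] at this
  have hp := Real.exp_pos (1 / 4)
  have h2 : (3 / 4 : ℝ) * Real.exp (1 / 4) ≤ 1 := by
    rw [← le_div_iff₀ hp, one_div]
    norm_num at this ⊢; linarith
  linarith

theorem LCN.exp_moment {f : ℕ → ℝ} (h : LCN f) (hs : Summable f) (h0 : 1 / 2 ≤ ∑' k, f k)
    (h1 : ∑' k : ℕ, (k : ℝ) * f k ≤ 1 / 2) :
    Summable (fun k : ℕ => (Real.exp (k / 4) - 1) * f k) ∧
      ∑' k : ℕ, (Real.exp (k / 4) - 1) * f k ≤ 1 / 2 := by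
  have hT := h.tail hs
  have hTs := h.tail_summable hs
  have hS := hT.tail hTs
  have hS1 := (h.S1 hs).trans h1
  have hS0 := tl_succ hTs 0
  have hT0 : 1 / 2 ≤ tl f 0 := by simpa [tl] using h0
  simp only [zero_add] at hS0
  have hstep : ∀ n, tl (tl f) (n + 1) ≤ tl (tl f) n / 2 := by
    intro n
    have := hS.a1 0 n
    simp only [zero_add] at this
    have hp : 0 < tl (tl f) 0 := by linarith [hS.nn 1]
    refine le_of_mul_le_mul_left ?_ hp
    have h3 : tl (tl f) 1 * tl (tl f) n ≤ (tl (tl f) 0 / 2) * tl (tl f) n :=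
      mul_le_mul_of_nonneg_right (by linarith) (hS.nn n)
    linarith
  have hgeo : ∀ n, tl (tl f) (n + 1) ≤ (1 / 2) ^ (n + 1) := by
    intro n
    induction n with
    | zero => simpa using hS1
    | succ n ih =>
      have := hstep (n + 1)
      rw [pow_succ]
      linarith
  have hTg : ∀ n, tl f (n + 1) ≤ (1 / 2) ^ (n + 1) := fun n => by
    have := tl_succ hTs (n + 1)
    linarith [hgeo n, hS.nn (n + 1 + 1)]
  have hφ : ∀ k : ℕ, 0 ≤ Real.exp ((k : ℝ) / 4) - 1 := fun k => by
    have := Real.add_one_le_exp ((k : ℝ) / 4)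
    have : (0 : ℝ) ≤ (k : ℝ) / 4 := by positivity
    linarith
  refine summ_partial (fun n => mul_nonneg (hφ n) (h.nn n)) ?_
  intro N
  have hab := abel hs (fun k : ℕ => Real.exp ((k : ℝ) / 4) - 1) (by simp) N
  have h2 : 0 ≤ (Real.exp ((N : ℝ) / 4) - 1) * tl f (N + 1) :=
    mul_nonneg (hφ N) (tl_nonneg h.nn _)
  set ρ := Real.exp (1 / 4) with hρ
  have hρ1 : 1 ≤ ρ := Real.one_le_exp (by norm_num)
  have hρ2 : ρ ≤ 4 / 3 := exp_quarter
  have hpow : ∀ k : ℕ, Real.exp ((k : ℝ) / 4) = ρ ^ k := fun k => by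
    rw [hρ, ← Real.exp_nat_mul]; congr 1; ring
  have h5 : ∑ k ∈ Finset.range N, ((Real.exp (((k + 1 : ℕ) : ℝ) / 4) - 1) -
      (Real.exp ((k : ℝ) / 4) - 1)) * tl f (k + 1) ≤
      ∑ k ∈ Finset.range N, (1 / 6) * (2 / 3 : ℝ) ^ k := by
    refine Finset.sum_le_sum fun k _ => ?_
    rw [hpow, hpow]
    have e : ρ ^ (k + 1) - 1 - (ρ ^ k - 1) = (ρ - 1) * ρ ^ k := by ring
    rw [e]
    calc (ρ - 1) * ρ ^ k * tl f (k + 1) ≤ (1 / 3) * (4 / 3) ^ k * (1 / 2) ^ (k + 1) := by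
          gcongr
          · exact tl_nonneg h.nn _
          · linarith
          · exact hTg k
      _ = _ := by
          rw [pow_succ, show (2 / 3 : ℝ) = 4 / 3 * (1 / 2) by norm_num, mul_pow]; ring
  have h6 : ∑ k ∈ Finset.range N, (1 / 6) * (2 / 3 : ℝ) ^ k ≤ 1 / 2 := by
    rw [← Finset.mul_sum, geom_sum_eq (by norm_num)]
    have : (0 : ℝ) ≤ (2 / 3) ^ N := by positivity
    rw [show (2 / 3 - 1 : ℝ) = -(1 / 3) by norm_num, div_neg, div_div_eq_mul_div]
    linarith
  linarith

theorem gamma_lower {r : ℝ} (hr : 1 ≤ r) : 2 * (r ^ r * Real.exp (-r)) ≤ Real.Gamma (r + 1) := by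
  have hr0 : 0 < r := by linarith
  have hconv := Real.GammaIntegral_convergent (s := r + 1) (by linarith)
  rw [Real.Gamma_eq_integral (by linarith)]
  have hd : ∀ x ∈ Set.Ici r, HasDerivAt (fun t : ℝ => -((2 + t - r) * Real.exp (-t)))
      ((1 + x - r) * Real.exp (-x)) x := by
    intro x _
    have h1 : HasDerivAt (fun t : ℝ => 2 + t - r) 1 x :=
      ((hasDerivAt_id x).const_add 2).sub_const r
    have h2 : HasDerivAt (fun t : ℝ => Real.exp (-t)) (Real.exp (-x) * (-1)) x :=
      (hasDerivAt_neg x).exp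
    have h3 := (h1.mul h2).neg
    refine h3.congr_deriv ?_
    ring
  have hpos : ∀ x ∈ Set.Ioi r, 0 ≤ (1 + x - r) * Real.exp (-x) := by
    intro x hx
    have : r < x := hx
    exact mul_nonneg (by linarith) (Real.exp_pos _).le
  have hlim : Filter.Tendsto (fun t : ℝ => -((2 + t - r) * Real.exp (-t))) Filter.atTop
      (nhds 0) := by
    have h1 := Real.tendsto_pow_mul_exp_neg_atTop_nhds_zero 1
    have h0 := Real.tendsto_pow_mul_exp_neg_atTop_nhds_zero 0
    have := ((h0.const_mul (2 - r)).add h1).neg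
    simp only [mul_zero, add_zero, neg_zero] at this
    refine this.congr fun t => ?_
    ring
  have hint := integral_Ioi_of_hasDerivAt_of_nonneg' hd hpos hlim
  have hintb := integrableOn_Ioi_deriv_of_nonneg' hd hpos hlim
  have hsub : Set.Ioi r ⊆ Set.Ioi 0 := Set.Ioi_subset_Ioi hr0.le
  have step1 : ∫ x in Set.Ioi r, Real.exp (-x) * x ^ (r + 1 - 1) ≤
      ∫ x in Set.Ioi 0, Real.exp (-x) * x ^ (r + 1 - 1) := by
    refine setIntegral_mono_set hconv ?_ hsub.eventuallyLE
    filter_upwards [ae_restrict_mem measurableSet_Ioi] with x hx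
    have : (0 : ℝ) < x := hx
    simp only [Pi.zero_apply]
    positivity
  refine le_trans ?_ step1
  have step2 : ∫ x in Set.Ioi r, r ^ r * ((1 + x - r) * Real.exp (-x)) ≤
      ∫ x in Set.Ioi r, Real.exp (-x) * x ^ (r + 1 - 1) := by
    refine setIntegral_mono_on (hintb.const_mul _) (hconv.mono_set hsub) measurableSet_Ioi ?_
    intro x hx
    have hx' : r < x := hx
    have hb := one_add_mul_self_le_rpow_one_add (s := (x - r) / r)
      (by have : 0 ≤ (x - r) / r := div_nonneg (by linarith) hr0.le
          linarith) hr
    have e1 : 1 + r * ((x - r) / r) = 1 + x - r := by field_simp; ring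
    have e2 : 1 + (x - r) / r = x / r := by field_simp; ring
    rw [e1, e2, Real.div_rpow (by linarith) hr0.le, le_div_iff₀ (by positivity)] at hb
    have e3 : r + 1 - 1 = r := by ring
    rw [e3]
    have := mul_le_mul_of_nonneg_right hb (Real.exp_pos (-x)).le
    linarith
  refine le_trans (le_of_eq ?_) step2
  rw [integral_const_mul, hint]
  ring

theorem rpow_le_gamma {r y : ℝ} (hr : 1 ≤ r) (hy : 0 ≤ y) :
    2 * y ^ r ≤ Real.Gamma (r + 1) * Real.exp y := by
  have hr0 : 0 < r := by linarith
  have h1 := gamma_lower hr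
  have h2 : y ^ r ≤ r ^ r * Real.exp (-r) * Real.exp y := by
    have : y / r ≤ Real.exp (y / r - 1) := by
      have := Real.add_one_le_exp (y / r - 1); linarith
    have h3 := Real.rpow_le_rpow (div_nonneg hy hr0.le) this hr0.le
    rw [Real.div_rpow hy hr0.le, div_le_iff₀ (by positivity), ← Real.exp_mul] at h3
    refine h3.trans (le_of_eq ?_)
    have : (y / r - 1) * r = -r + y := by field_simp; ring
    rw [this, Real.exp_add]; ring
  have := mul_le_mul_of_nonneg_right h1 (Real.exp_pos y).le
  linarith

theorem rpow_le_sqrt {q s z : ℝ} (hq : 1 ≤ q) (hs : 0 < s) (hz : 0 ≤ z) :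
    Real.sqrt 2 * z ^ q ≤
      (1 / s) ^ q * Real.sqrt (Real.Gamma (2 * q + 1)) * Real.exp (s * z / 2) := by
  have hG : 0 < Real.Gamma (2 * q + 1) := Real.Gamma_pos_of_pos (by linarith)
  have h := rpow_le_gamma (r := 2 * q) (y := s * z) (by linarith) (by positivity)
  refine le_of_sq_le_sq ?_ (by positivity)
  have e1 : (Real.sqrt 2 * z ^ q) ^ 2 = 2 * z ^ (2 * q) := by
    rw [mul_pow, Real.sq_sqrt (by norm_num), ← Real.rpow_natCast (z ^ q) 2, ← Real.rpow_mul hz]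
    congr 2; push_cast; ring
  have e2 : ((1 / s) ^ q * Real.sqrt (Real.Gamma (2 * q + 1)) * Real.exp (s * z / 2)) ^ 2 =
      (1 / s) ^ (2 * q) * (Real.Gamma (2 * q + 1) * Real.exp (s * z)) := by
    rw [mul_pow, mul_pow, Real.sq_sqrt hG.le, ← Real.rpow_natCast ((1 / s) ^ q) 2,
      ← Real.rpow_mul (by positivity), ← Real.exp_nat_mul, mul_assoc]
    congr 2
    · push_cast; ring
    · congr 1; push_cast; ring
  rw [e1, e2]
  have e3 : z ^ (2 * q) = (1 / s) ^ (2 * q) * (s * z) ^ (2 * q) := by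
    rw [← Real.mul_rpow (by positivity) (by positivity)]
    congr 1; field_simp
  rw [e3]
  have := mul_le_mul_of_nonneg_left h (by positivity : 0 ≤ (1 / s) ^ (2 * q))
  linarith

theorem lcn_of {p : ℤ → ℝ} (hn : ∀ k, 0 ≤ p k) (h : IsLogConcavePMF p) :
    LCN (fun n : ℕ => p n) ∧ LCN (fun n : ℕ => p (-(n : ℤ))) := by
  refine ⟨⟨fun n => hn _, fun n => ?_, fun a b c hab hbc ha hc => ?_⟩,
    ⟨fun n => hn _, fun n => ?_, fun a b c hab hbc ha hc => ?_⟩⟩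
  · have := h.1 ((n : ℤ) + 1)
    push_cast
    convert this using 3 <;> ring
  · exact h.2 a b c (by exact_mod_cast hab) (by exact_mod_cast hbc) ha hc
  · have := h.1 (-((n : ℤ) + 1))
    push_cast
    rw [mul_comm]
    convert this using 3 <;> ring
  · exact h.2 (-(c : ℤ)) (-(b : ℤ)) (-(a : ℤ)) (by omega) (by omega) hc ha

theorem exp_moment_int {p : ℤ → ℝ} (hn : ∀ k, 0 ≤ p k) (h : IsLogConcavePMF p)
    (hp : HasSum p 1) (hc : (∑' k : ℤ, (k : ℝ) * p k) = 0)
    (hm : (∑' k : ℤ, |(k : ℝ)| * p k) ≤ 1) :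
    Summable (fun k : ℤ => Real.exp (|(k : ℝ)| / 4) * p k) ∧
      ∑' k : ℤ, Real.exp (|(k : ℝ)| / 4) * p k ≤ 2 := by
  obtain ⟨hA, hB⟩ := lcn_of hn h
  have sA : Summable (fun n : ℕ => p n) := hp.summable.comp_injective Nat.cast_injective
  have sB : Summable (fun n : ℕ => p (-(n : ℤ))) :=
    hp.summable.comp_injective (neg_injective.comp Nat.cast_injective)
  have mA := hA.moment_summable sA
  have mB := hB.moment_summable sB
  have tot : ∑' n : ℕ, p n + ∑' n : ℕ, p (-(n : ℤ)) - p 0 = 1 :=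
    (HasSum.of_nat_of_neg sA.hasSum sB.hasSum).unique hp
  have e1 : HasSum (fun k : ℤ => (k : ℝ) * p k) (∑' n : ℕ, (n : ℝ) * p n +
      -∑' n : ℕ, (n : ℝ) * p (-(n : ℤ)) - ((0 : ℤ) : ℝ) * p 0) := by
    apply HasSum.of_nat_of_neg
    · simpa using mA.hasSum
    · simpa using mB.hasSum.neg
  have e2 : HasSum (fun k : ℤ => |(k : ℝ)| * p k) (∑' n : ℕ, (n : ℝ) * p n +
      ∑' n : ℕ, (n : ℝ) * p (-(n : ℤ)) - |((0 : ℤ) : ℝ)| * p 0) := by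
    apply HasSum.of_nat_of_neg
    · simpa using mA.hasSum
    · simpa using mB.hasSum
  rw [e1.tsum_eq] at hc
  rw [e2.tsum_eq] at hm
  simp only [Int.cast_zero, abs_zero, zero_mul, sub_zero] at hc hm
  have side : ∀ f : ℕ → ℝ, LCN f → Summable f → Summable (fun k : ℕ => (k : ℝ) * f k) →
      ∑' n, f n - f 0 ≤ ∑' n : ℕ, (n : ℝ) * f n := by
    intro f hf hs hm
    rw [hs.tsum_eq_zero_add, hm.tsum_eq_zero_add]
    simp only [Nat.cast_zero, zero_mul, zero_add, add_sub_cancel_left]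
    refine Summable.tsum_le_tsum ?_ ((summable_nat_add_iff 1).2 hs) ((summable_nat_add_iff 1).2 hm)
    intro n
    have := hf.nn (n + 1)
    push_cast
    nlinarith [n.cast_nonneg (α := ℝ)]
  have sdA := side _ hA sA mA
  have sdB := side _ hB sB mB
  simp only [Nat.cast_zero, neg_zero] at sdA sdB
  obtain ⟨xA, yA⟩ := hA.exp_moment sA (by linarith) (by linarith)
  obtain ⟨xB, yB⟩ := hB.exp_moment sB (by linarith) (by linarith)
  have e3 : HasSum (fun k : ℤ => (Real.exp (|(k : ℝ)| / 4) - 1) * p k)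
      (∑' n : ℕ, (Real.exp (n / 4) - 1) * p n +
      ∑' n : ℕ, (Real.exp (n / 4) - 1) * p (-(n : ℤ)) -
        (Real.exp (|((0 : ℤ) : ℝ)| / 4) - 1) * p 0) := by
    apply HasSum.of_nat_of_neg
    · simpa using xA.hasSum
    · simpa using xB.hasSum
  have e4 := e3.add hp
  have e5 : (fun k : ℤ => (Real.exp (|(k : ℝ)| / 4) - 1) * p k + p k) =
      fun k : ℤ => Real.exp (|(k : ℝ)| / 4) * p k := by ext k; ring
  rw [e5] at e4
  refine ⟨e4.summable, ?_⟩
  rw [e4.tsum_eq]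
  simp only [Int.cast_zero, abs_zero, zero_div, Real.exp_zero, sub_self, zero_mul, sub_zero]
  linarith

theorem exp_moment_meas (μ : Measure ℤ) [IsProbabilityMeasure μ]
    (h : IsLogConcavePMF (fun k => (μ {k}).toReal))
    (hc : (∑' k : ℤ, (k : ℝ) * (μ {k}).toReal) = 0)
    (hm : (∑' k : ℤ, |(k : ℝ)| * (μ {k}).toReal) ≤ 1) :
    ∫⁻ k, ENNReal.ofReal (Real.exp (|(k : ℝ)| / 4)) ∂μ ≤ 2 := by
  have hsum : ∑' k : ℤ, μ {k} = 1 := by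
    have := lintegral_countable' (μ := μ) (fun _ => 1)
    simpa using this.symm
  have hp : HasSum (fun k : ℤ => (μ {k}).toReal) 1 := by
    have h1 : Summable (fun k : ℤ => (μ {k}).toReal) :=
      ENNReal.summable_toReal (by rw [hsum]; simp)
    have h2 := ENNReal.tsum_toReal_eq (f := fun k : ℤ => μ {k}) (fun k => measure_ne_top _ _)
    rw [hsum] at h2
    have h3 := h1.hasSum
    rw [← h2] at h3
    simpa using h3
  obtain ⟨x, y⟩ := exp_moment_int (fun k => ENNReal.toReal_nonneg) h hp hc hm
  rw [lintegral_countable']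
  have : ∀ k : ℤ, ENNReal.ofReal (Real.exp (|(k : ℝ)| / 4)) * μ {k} =
      ENNReal.ofReal (Real.exp (|(k : ℝ)| / 4) * (μ {k}).toReal) := fun k => by
    rw [ENNReal.ofReal_mul (Real.exp_pos _).le, ENNReal.ofReal_toReal (measure_ne_top _ _)]
  simp_rw [this]
  rw [← ENNReal.ofReal_tsum_of_nonneg (fun k => by positivity) x]
  exact (ENNReal.ofReal_le_ofReal y).trans (by simp)

theorem coupling_exp {μ ν : Measure ℤ} {π : Measure (ℤ × ℤ)}
    (h1 : π.map Prod.fst = μ) (h2 : π.map Prod.snd = ν)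
    (hμ : ∫⁻ k, ENNReal.ofReal (Real.exp (|(k : ℝ)| / 4)) ∂μ ≤ 2)
    (hν : ∫⁻ k, ENNReal.ofReal (Real.exp (|(k : ℝ)| / 4)) ∂ν ≤ 2) :
    ∫⁻ x, ENNReal.ofReal (Real.exp (|(x.1 : ℝ) - (x.2 : ℝ)| / 8)) ∂π ≤ 2 := by
  have e1 : ∫⁻ x, ENNReal.ofReal (Real.exp (|(x.1 : ℝ)| / 4)) ∂π ≤ 2 := by
    rw [← h1, lintegral_map (measurable_of_countable _) measurable_fst] at hμ
    exact hμ
  have e2 : ∫⁻ x, ENNReal.ofReal (Real.exp (|(x.2 : ℝ)| / 4)) ∂π ≤ 2 := by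
    rw [← h2, lintegral_map (measurable_of_countable _) measurable_snd] at hν
    exact hν
  calc ∫⁻ x, ENNReal.ofReal (Real.exp (|(x.1 : ℝ) - (x.2 : ℝ)| / 8)) ∂π
      ≤ ∫⁻ x, ENNReal.ofReal (1 / 2) * (ENNReal.ofReal (Real.exp (|(x.1 : ℝ)| / 4)) +
          ENNReal.ofReal (Real.exp (|(x.2 : ℝ)| / 4))) ∂π := by
        refine lintegral_mono fun x => ?_
        rw [← ENNReal.ofReal_add (Real.exp_pos _).le (Real.exp_pos _).le,
          ← ENNReal.ofReal_mul (by norm_num)]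
        refine ENNReal.ofReal_le_ofReal ?_
        set a := |(x.1 : ℝ)|
        set b := |(x.2 : ℝ)|
        have hab : |(x.1 : ℝ) - (x.2 : ℝ)| ≤ a + b := abs_sub _ _
        have h3 : Real.exp (|(x.1 : ℝ) - (x.2 : ℝ)| / 8) ≤ Real.exp (a / 8) * Real.exp (b / 8) := by
          rw [← Real.exp_add]; exact Real.exp_le_exp.2 (by linarith)
        have h4 : Real.exp (a / 4) = Real.exp (a / 8) ^ 2 := by
          rw [← Real.exp_nat_mul]; congr 1; push_cast; ring
        have h5 : Real.exp (b / 4) = Real.exp (b / 8) ^ 2 := by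
          rw [← Real.exp_nat_mul]; congr 1; push_cast; ring
        rw [h4, h5]
        nlinarith [sq_nonneg (Real.exp (a / 8) - Real.exp (b / 8))]
    _ = ENNReal.ofReal (1 / 2) * (∫⁻ x, ENNReal.ofReal (Real.exp (|(x.1 : ℝ)| / 4)) ∂π +
          ∫⁻ x, ENNReal.ofReal (Real.exp (|(x.2 : ℝ)| / 4)) ∂π) := by
        rw [lintegral_const_mul _ (measurable_of_countable _),
          lintegral_add_left (measurable_of_countable _)]
    _ ≤ ENNReal.ofReal (1 / 2) * (2 + 2) := by gcongr
    _ = 2 := by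
        have : (2 + 2 : ENNReal) = ENNReal.ofReal 4 := by
          norm_num
        rw [this, ← ENNReal.ofReal_mul (by norm_num)]
        norm_num

theorem iInf_affine {ι : Type*} [Nonempty ι] (f g : ι → ENNReal) (a b : ENNReal) (ha : a ≠ ⊤)
    (h : ∀ i, g i ≤ a * f i + b) : ⨅ i, g i ≤ a * (⨅ i, f i) + b := by
  rw [ENNReal.mul_iInf (fun h => absurd h ha), ENNReal.iInf_add]
  exact iInf_mono h

theorem pointwise_bd {p q R z : ℝ} (hp : 1 ≤ p) (hpq : p ≤ q) (hR : 0 ≤ R) (hz : 0 ≤ z) :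
    z ^ q ≤ R ^ (q - p) * z ^ p +
      (6 ^ q * Real.sqrt (Real.Gamma (2 * q + 1)) * Real.exp (-R / 24)) * Real.exp (z / 8) := by
  rcases le_or_gt z R with h | h
  · have h1 : z ^ q = z ^ (q - p) * z ^ p := by
      rcases hz.eq_or_lt with rfl | hz'
      · rw [Real.zero_rpow (by linarith), Real.zero_rpow (x := p) (by linarith), mul_zero]
      · rw [← Real.rpow_add hz']; congr 1; ring
    have h2 : z ^ (q - p) ≤ R ^ (q - p) := Real.rpow_le_rpow hz h (by linarith)
    have h3 : 0 ≤ (6 ^ q * Real.sqrt (Real.Gamma (2 * q + 1)) * Real.exp (-R / 24)) *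
      Real.exp (z / 8) := by positivity
    have h4 := mul_le_mul_of_nonneg_right h2 (Real.rpow_nonneg hz p)
    linarith
  · have h1 := rpow_le_sqrt (q := q) (s := 1 / 6) (z := z) (by linarith) (by norm_num) hz
    have h2 : 1 ≤ Real.sqrt 2 := Real.one_le_sqrt.2 (by norm_num)
    have h3 : 0 ≤ z ^ q := Real.rpow_nonneg hz q
    rw [one_div_one_div] at h1
    have h4 : 0 ≤ R ^ (q - p) * z ^ p := mul_nonneg (Real.rpow_nonneg hR _) (Real.rpow_nonneg hz _)
    have h5 : Real.exp (1 / 6 * z / 2) ≤ Real.exp (-R / 24) * Real.exp (z / 8) := by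
      rw [← Real.exp_add]; exact Real.exp_le_exp.2 (by linarith)
    have h6 := mul_le_mul_of_nonneg_left h5
      (by positivity : 0 ≤ 6 ^ q * Real.sqrt (Real.Gamma (2 * q + 1)))
    nlinarith

theorem Wq_le_Wp_universal
    (μ ν : Measure ℤ) [IsProbabilityMeasure μ] [IsProbabilityMeasure ν]
    (hμlc : IsLogConcavePMF (fun k => (μ {k}).toReal))
    (hνlc : IsLogConcavePMF (fun k => (ν {k}).toReal))
    (hμc : (∑' k : ℤ, (k : ℝ) * (μ {k}).toReal) = 0)
    (hνc : (∑' k : ℤ, (k : ℝ) * (ν {k}).toReal) = 0)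
    (hμm : (∑' k : ℤ, |(k : ℝ)| * (μ {k}).toReal) ≤ 1)
    (hνm : (∑' k : ℤ, |(k : ℝ)| * (ν {k}).toReal) ≤ 1)
    (p q : ℝ) (hp : 1 ≤ p) (hpq : p ≤ q) :
    WassersteinPow q μ ν ≤
      24 ^ (q - p) * WassersteinPow p μ ν *
        (Real.log (6 ^ q * Real.sqrt (Real.Gamma (2 * q + 1)) /
          WassersteinPow p μ ν)) ^ (q - p) +
      2 * WassersteinPow p μ ν := by
  have hμe := exp_moment_meas μ hμlc hμc hμm
  have hνe := exp_moment_meas ν hνlc hνc hνm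
  set S : Set (Measure (ℤ × ℤ)) := {π | π.map Prod.fst = μ ∧ π.map Prod.snd = ν} with hS
  let I : ℝ → S → ENNReal := fun r π =>
    ∫⁻ x, ENNReal.ofReal (|(x.1 : ℝ) - (x.2 : ℝ)| ^ r) ∂π.1
  have hW : ∀ r, WassersteinPow r μ ν = (⨅ π : S, I r π).toReal := by
    intro r
    rw [WassersteinPow, iInf_subtype']
  have hne : Nonempty S := ⟨⟨μ.prod ν, by simp [hS]⟩⟩
  have hE : ∀ π : S, ∫⁻ x, ENNReal.ofReal (Real.exp (|(x.1 : ℝ) - (x.2 : ℝ)| / 8)) ∂π.1 ≤ 2 :=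
    fun π => coupling_exp π.2.1 π.2.2 hμe hνe
  have hq : 1 ≤ q := hp.trans hpq
  set G := Real.sqrt (Real.Gamma (2 * q + 1)) with hG
  have hG0 : 0 < G := Real.sqrt_pos.2 (Real.Gamma_pos_of_pos (by linarith))
  set C := 6 ^ q * G with hC
  have hC0 : 0 < C := by positivity
  have hs2 : 0 < Real.sqrt 2 := by positivity
  -- finiteness and the a priori bound
  have hIq : ∀ π : S, I q π ≤ ENNReal.ofReal C := by
    intro π
    calc I q π ≤ ∫⁻ x, ENNReal.ofReal (4 ^ q * G / Real.sqrt 2) *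
          ENNReal.ofReal (Real.exp (|(x.1 : ℝ) - (x.2 : ℝ)| / 8)) ∂π.1 := by
          refine lintegral_mono fun x => ?_
          rw [← ENNReal.ofReal_mul (by positivity)]
          refine ENNReal.ofReal_le_ofReal ?_
          have := rpow_le_sqrt (q := q) (s := 1 / 4) hq (by norm_num)
            (abs_nonneg ((x.1 : ℝ) - (x.2 : ℝ)))
          rw [one_div_one_div] at this
          rw [div_mul_eq_mul_div, le_div_iff₀ hs2, mul_comm]
          refine this.trans (le_of_eq ?_)
          congr 2
          ring
      _ = ENNReal.ofReal (4 ^ q * G / Real.sqrt 2) *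
          ∫⁻ x, ENNReal.ofReal (Real.exp (|(x.1 : ℝ) - (x.2 : ℝ)| / 8)) ∂π.1 :=
          lintegral_const_mul _ (measurable_of_countable _)
      _ ≤ ENNReal.ofReal (4 ^ q * G / Real.sqrt 2) * ENNReal.ofReal 2 := by
          gcongr
          simpa using hE π
      _ ≤ ENNReal.ofReal C := by
          rw [← ENNReal.ofReal_mul (by positivity)]
          refine ENNReal.ofReal_le_ofReal ?_
          have h1 : (6 : ℝ) ^ q = 4 ^ q * (3 / 2) ^ q := by
            rw [← Real.mul_rpow (by norm_num) (by norm_num)]; norm_num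
          have h2 : (3 / 2 : ℝ) ≤ (3 / 2) ^ q := by
            simpa using Real.rpow_le_rpow_of_exponent_le (x := 3 / 2) (by norm_num) hq
          have h3 : Real.sqrt 2 ≤ 3 / 2 := Real.sqrt_le_iff.2 ⟨by norm_num, by norm_num⟩
          have h4 : 2 / Real.sqrt 2 = Real.sqrt 2 := Real.div_sqrt
          have : 4 ^ q * G / Real.sqrt 2 * 2 = 4 ^ q * G * (2 / Real.sqrt 2) := by ring
          rw [this, h4, hC, h1]
          have := mul_le_mul_of_nonneg_left (h3.trans h2) (by positivity : 0 ≤ 4 ^ q * G)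
          linarith
  have hIpq : ∀ π : S, I p π ≤ I q π := by
    intro π
    refine lintegral_mono fun x => ENNReal.ofReal_le_ofReal ?_
    have e : |(x.1 : ℝ) - (x.2 : ℝ)| = ((|x.1 - x.2| : ℤ) : ℝ) := by push_cast; rfl
    rw [e]
    rcases (abs_nonneg (x.1 - x.2)).eq_or_lt with h | h
    · rw [← h, Int.cast_zero, Real.zero_rpow (by linarith), Real.zero_rpow (by linarith)]
    · exact Real.rpow_le_rpow_of_exponent_le (by exact_mod_cast h) hpq
  have hVp : ⨅ π : S, I p π ≤ ENNReal.ofReal C :=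
    (iInf_mono hIpq).trans ((iInf_le _ hne.some).trans (hIq _))
  have hVpt : ⨅ π : S, I p π ≠ ⊤ := ne_top_of_le_ne_top ENNReal.ofReal_ne_top hVp
  -- truncation
  have key : ∀ R : ℝ, 0 ≤ R → WassersteinPow q μ ν ≤
      R ^ (q - p) * WassersteinPow p μ ν + C * Real.exp (-R / 24) * 2 := by
    intro R hR
    have hR' : 0 ≤ R ^ (q - p) := Real.rpow_nonneg hR _
    have hpt : ∀ π : S, I q π ≤ ENNReal.ofReal (R ^ (q - p)) * I p π +
        ENNReal.ofReal (C * Real.exp (-R / 24) * 2) := by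
      intro π
      calc I q π ≤ ∫⁻ x, (ENNReal.ofReal (R ^ (q - p)) *
            ENNReal.ofReal (|(x.1 : ℝ) - (x.2 : ℝ)| ^ p) + ENNReal.ofReal (C * Real.exp (-R / 24)) *
            ENNReal.ofReal (Real.exp (|(x.1 : ℝ) - (x.2 : ℝ)| / 8))) ∂π.1 := by
            refine lintegral_mono fun x => ?_
            rw [← ENNReal.ofReal_mul hR', ← ENNReal.ofReal_mul (by positivity),
              ← ENNReal.ofReal_add (by positivity) (by positivity)]
            exact ENNReal.ofReal_le_ofReal (pointwise_bd hp hpq hR (abs_nonneg _))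
        _ = ENNReal.ofReal (R ^ (q - p)) * I p π + ENNReal.ofReal (C * Real.exp (-R / 24)) *
            ∫⁻ x, ENNReal.ofReal (Real.exp (|(x.1 : ℝ) - (x.2 : ℝ)| / 8)) ∂π.1 := by
            rw [lintegral_add_left (measurable_of_countable _),
              lintegral_const_mul _ (measurable_of_countable _),
              lintegral_const_mul _ (measurable_of_countable _)]
        _ ≤ _ := by
            rw [ENNReal.ofReal_mul (p := C * Real.exp (-R / 24)) (by positivity)]
            gcongr
            simpa using hE π
    have h1 := iInf_affine _ _ _ _ ENNReal.ofReal_ne_top hpt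
    have h2 := ENNReal.toReal_mono
      (ENNReal.add_ne_top.2 ⟨ENNReal.mul_ne_top ENNReal.ofReal_ne_top hVpt, ENNReal.ofReal_ne_top⟩) h1
    rw [ENNReal.toReal_add (ENNReal.mul_ne_top ENNReal.ofReal_ne_top hVpt) ENNReal.ofReal_ne_top,
      ENNReal.toReal_mul, ENNReal.toReal_ofReal hR', ENNReal.toReal_ofReal (by positivity),
      ← hW, ← hW] at h2
    exact h2
  have hWC : WassersteinPow p μ ν ≤ C := by
    rw [hW]
    exact ENNReal.toReal_le_of_le_ofReal hC0.le hVp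
  have hW0 : 0 ≤ WassersteinPow p μ ν := ENNReal.toReal_nonneg
  rcases hW0.eq_or_lt with h0 | h0
  · rw [← h0] at key ⊢
    simp only [mul_zero, zero_mul, zero_add] at key ⊢
    have hlim : Filter.Tendsto (fun R : ℝ => C * Real.exp (-R / 24) * 2) Filter.atTop (nhds 0) := by
      have h1 : Filter.Tendsto (fun R : ℝ => -R / 24) Filter.atTop Filter.atBot :=
        Filter.tendsto_neg_atTop_atBot.atBot_div_const (by norm_num)
      have h2 := ((Real.tendsto_exp_atBot.comp h1).const_mul C).mul_const 2
      simpa using h2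
    refine ge_of_tendsto hlim ?_
    filter_upwards [Filter.eventually_ge_atTop 0] with R hR using key R hR
  · set W := WassersteinPow p μ ν
    have hL : 0 ≤ Real.log (C / W) := Real.log_nonneg ((one_le_div h0).2 hWC)
    refine (key (24 * Real.log (C / W)) (by positivity)).trans (le_of_eq ?_)
    have e1 : -(24 * Real.log (C / W)) / 24 = -Real.log (C / W) := by ring
    rw [e1, Real.exp_neg, Real.exp_log (by positivity), Real.mul_rpow (by norm_num) hL]
    field_simp
end

section
/- Let a > 0 and c ≥ 2. Let ν be a probability measure on ℤ whose probability mass function belongs to the class Q(a, c), and let μ be a centered (mean-zero) log-concave probability measure on ℤ with variance at most 1 whose support is contained in the support of ν. Then D(μ‖ν) ≤ d_TV(μ, ν)·( 288·a·log²( √2·(9 + log(c) + 51a) / d_TV(μ, ν) ) + 2·log(c) + 1 ). -/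
open MeasureTheory ProbabilityTheory
open scoped ProbabilityTheory

/-- The class `Q(a,c)` of functions `q : ℤ → [0,1]` such that
`log(1/q(k)) ≤ a·k² + log(c)` for all `k` in the support of `q`. -/
def MemQClass (a c : ℝ) (q : ℤ → ℝ) : Prop :=
  (∀ k : ℤ, 0 ≤ q k ∧ q k ≤ 1) ∧
  (∀ k : ℤ, 0 < q k → Real.log (1 / q k) ≤ a * (k : ℝ) ^ 2 + Real.log c)

/-- The Kullback–Leibler divergence `D(μ‖ν) = Σ_k μ({k})·log(μ({k})/ν({k}))`,
expressed through the probability mass functions `p` of `μ` and `q` of `ν`. -/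
noncomputable def KLdiv (p q : ℤ → ℝ) : ℝ :=
  ∑' k : ℤ, p k * Real.log (p k / q k)

/-- The total variation distance `d_TV(μ,ν) = Σ_k |μ({k}) − ν({k})|`, expressed
through the probability mass functions `p` of `μ` and `q` of `ν`. -/
noncomputable def dTV (p q : ℤ → ℝ) : ℝ :=
  ∑' k : ℤ, |p k - q k|


theorem aux_step (p : ℤ → ℝ) (h0 : ∀ k, 0 ≤ p k) (hlc : IsLogConcavePMF p) (r : ℝ)
    (j k : ℤ) (hj : 0 < p j) (hjk : j ≤ k) (h : p (k + 1) ≤ r * p k) :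
    p (k + 1 + 1) ≤ r * p (k + 1) := by
  rcases (h0 (k+1)).eq_or_lt with h1 | h1
  · rcases (h0 (k+1+1)).eq_or_lt with h2 | h2
    · rw [← h1, ← h2]; simp
    · have := hlc.2 j (k+1) (k+1+1) (by omega) (by omega) hj h2
      linarith
  · have hk : 0 < p k := hlc.2 j k (k+1) hjk (by omega) hj h1
    have h3 := hlc.1 (k+1)
    rw [show k + 1 - 1 = k by ring] at h3
    have : p k * p (k+1+1) ≤ p k * (r * p (k+1)) := by nlinarith
    exact le_of_mul_le_mul_left this hk

theorem aux_steps (p : ℤ → ℝ) (h0 : ∀ k, 0 ≤ p k) (hlc : IsLogConcavePMF p) (r : ℝ)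
    (j k : ℤ) (hj : 0 < p j) (hjk : j ≤ k) (h : p (k + 1) ≤ r * p k) (n : ℕ) :
    p (k + n + 1) ≤ r * p (k + n) := by
  induction n with
  | zero => simpa using h
  | succ n ih =>
    have := aux_step p h0 hlc r j (k+n) hj (by omega) ih
    push_cast
    rwa [← add_assoc]

theorem aux_geom (p : ℤ → ℝ) (h0 : ∀ k, 0 ≤ p k) (hlc : IsLogConcavePMF p) (r : ℝ) (hr : 0 ≤ r)
    (j k : ℤ) (hj : 0 < p j) (hjk : j ≤ k) (h : p (k + 1) ≤ r * p k) (n : ℕ) :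
    p (k + n) ≤ r ^ n * p k := by
  induction n with
  | zero => simp
  | succ n ih =>
    have := aux_steps p h0 hlc r j k hj hjk h n
    push_cast
    rw [← add_assoc, pow_succ]
    nlinarith

theorem aux_neg (p : ℤ → ℝ) (hlc : IsLogConcavePMF p) : IsLogConcavePMF (fun k => p (-k)) := by
  refine ⟨fun k => ?_, fun a b c hab hbc ha hc => ?_⟩
  · have := hlc.1 (-k)
    simp only
    rw [show -(k-1) = -k+1 by ring, show -(k+1) = -k-1 by ring]
    linarith
  · exact hlc.2 (-c) (-b) (-a) (by omega) (by omega) hc ha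

theorem aux_summ_nat (p : ℤ → ℝ) (h0 : ∀ k, 0 ≤ p k) (hlc : IsLogConcavePMF p)
    (hs : HasSum p 1) : Summable (fun n : ℕ => ((n : ℤ) : ℝ) ^ 2 * p n) := by
  obtain ⟨j, hj⟩ : ∃ j, 0 < p j := by
    by_contra! h
    have : p = fun _ => 0 := funext fun k => le_antisymm (h k) (h0 k)
    rw [this] at hs
    have := hs.unique hasSum_zero
    norm_num at this
  set m : ℕ := j.toNat
  have hjm : j ≤ m := Int.self_le_toNat j
  obtain ⟨k, r, hjk, hr0, hr1, hk⟩ : ∃ (k : ℕ) (r : ℝ), j ≤ k ∧ 0 ≤ r ∧ r < 1 ∧ p (k+1) ≤ r * p k := by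
    by_contra! hcon
    have hmono : ∀ n : ℕ, p m ≤ p (m + n) ∧ (p (m+n) = 0 → False) := by
      have key : ∀ k : ℕ, j ≤ k → 0 < p k ∧ p k ≤ p (k+1) := by
        intro k hk
        have h1 := hcon k 0 hk le_rfl (by norm_num)
        have h2 : 0 < p k := hlc.2 j k (k+1) hk (by omega) hj (by simpa using h1)
        refine ⟨h2, ?_⟩
        by_contra! h3
        have := hcon k (p (k+1) / p k) hk (by have := h0 (k+1); positivity)
          (by rw [div_lt_one h2]; exact h3)
        rw [div_mul_cancel₀ _ h2.ne'] at this
        exact lt_irrefl _ this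
      intro n
      induction n with
      | zero =>
        have := (key m hjm).1
        simp; exact this.ne'
      | succ n ih =>
        have h1 := key (m+n) (by push_cast; omega)
        have h2 := key (m+n+1) (by push_cast; omega)
        push_cast at *
        rw [← add_assoc]
        exact ⟨ih.1.trans h1.2, h2.1.ne'⟩
    have hp0 : 0 < p m := by
      have := (hmono 0).2
      simp at this
      exact lt_of_le_of_ne (h0 _) (Ne.symm this)
    have hsn : Summable (fun n : ℕ => p (m + n)) :=
      hs.summable.comp_injective (i := fun n : ℕ => (m:ℤ) + n) (fun a b h => by simpa using h)
    have ht := hsn.tendsto_atTop_zero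
    have := ge_of_tendsto' ht (fun n => (hmono n).1)
    linarith
  rw [← summable_nat_add_iff k]
  have hg := aux_geom p h0 hlc r hr0 j k hj hjk hk
  have hsum : Summable (fun n : ℕ => ((n+k:ℕ):ℝ)^2 * r^n * p k) := by
    apply Summable.mul_right
    have e1 := summable_pow_mul_geometric_of_norm_lt_one (R := ℝ) 2 (r := r)
      (by rw [Real.norm_of_nonneg hr0]; exact hr1)
    have e2 := summable_pow_mul_geometric_of_norm_lt_one (R := ℝ) 1 (r := r)
      (by rw [Real.norm_of_nonneg hr0]; exact hr1)
    have e3 := summable_pow_mul_geometric_of_norm_lt_one (R := ℝ) 0 (r := r)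
      (by rw [Real.norm_of_nonneg hr0]; exact hr1)
    refine ((e1.add (e2.mul_left (2*(k:ℝ)))).add (e3.mul_left ((k:ℝ)^2))).congr ?_
    intro n; push_cast; ring
  refine Summable.of_nonneg_of_le (fun n => mul_nonneg (sq_nonneg _) (h0 _)) (fun n => ?_) hsum
  have := hg n
  rw [mul_assoc]
  have e : (((n + k : ℕ)) : ℤ) = k + n := by push_cast; ring
  rw [e]
  have e' : (((k + n : ℤ)) : ℝ) = ((n+k:ℕ):ℝ) := by push_cast; ring
  rw [e']
  exact mul_le_mul_of_nonneg_left this (sq_nonneg _)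

theorem aux_hs_neg (p : ℤ → ℝ) (x : ℝ) (hs : HasSum p x) : HasSum (fun k => p (-k)) x :=
  (Equiv.neg ℤ).hasSum_iff.mpr hs

theorem aux_summ (p : ℤ → ℝ) (h0 : ∀ k, 0 ≤ p k) (hlc : IsLogConcavePMF p)
    (hs : HasSum p 1) : Summable (fun k : ℤ => (k : ℝ) ^ 2 * p k) := by
  apply Summable.of_nat_of_neg
  · exact aux_summ_nat p h0 hlc hs
  · have := aux_summ_nat _ (fun k => h0 (-k)) (aux_neg p hlc) (aux_hs_neg p 1 hs)
    refine this.congr fun n => ?_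
    push_cast; ring

theorem aux_tail (p : ℤ → ℝ) (h0 : ∀ k, 0 ≤ p k) (hlc : IsLogConcavePMF p)
    (hs : HasSum p 1) (hs2 : Summable (fun k : ℤ => (k : ℝ) ^ 2 * p k))
    (hv : (∑' k : ℤ, (k : ℝ) ^ 2 * p k) ≤ 1) (n : ℕ) :
    p n ≤ 5 / 4 * (4 / 5) ^ n := by
  have hle1 : ∀ k, p k ≤ 1 := fun k => le_hasSum hs k (fun j _ => h0 j)
  have hsq : ∀ k : ℤ, (k:ℝ)^2 * p k ≤ 1 := fun k =>
    (hs2.le_tsum k (fun j _ => mul_nonneg (sq_nonneg _) (h0 j))).trans hv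
  have h2 := hsq 2
  have h3 := hsq 3
  have h4 := hsq 4
  norm_num at h2 h3 h4
  have hsum : 3/4 ≤ p (-1) + p 0 + p 1 := by
    have hf : HasSum (fun k : ℤ => (1/4) * ((k:ℝ)^2 * p k) - p k)
      ((1/4) * (∑' k : ℤ, (k : ℝ) ^ 2 * p k) - 1) := (hs2.hasSum.mul_left (1/4)).sub hs
    have := sum_le_hasSum ({-1, 0, 1} : Finset ℤ) (fun k hk => ?_) hf
    · simp at this
      have := h0 (-1); have := h0 1
      linarith
    · have hk' : 2 ≤ |k| := by
        simp at hk
        rcases abs_cases k with h | h <;> omega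
      have : (2:ℝ) ≤ |(k:ℝ)| := by exact_mod_cast hk'
      have h5 : (4:ℝ) ≤ (k:ℝ)^2 := by rw [← sq_abs]; nlinarith
      nlinarith [h0 k]
  obtain ⟨j, hj1, hj2, hj⟩ : ∃ j : ℤ, -1 ≤ j ∧ j ≤ 1 ∧ 1/4 ≤ p j := by
    by_contra! h
    have a1 := h (-1) (by norm_num) (by norm_num)
    have a2 := h 0 (by norm_num) (by norm_num)
    have a3 := h 1 (by norm_num) (by norm_num)
    linarith
  have hjp : 0 < p j := by linarith
  have h43 : p (3+1) ≤ 4/5 * p 3 := by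
    by_contra! hc
    have hd : ∀ k : ℤ, j ≤ k → k ≤ 3 → 4/5 * p k < p (k+1) := by
      intro k hk hk3
      by_contra! hcc
      have := aux_steps p h0 hlc (4/5) j k hjp hk hcc (3-k).toNat
      rw [Int.toNat_of_nonneg (by omega), show k + (3-k) = 3 by ring] at this
      linarith
    have d3 := hd 3 (by omega) (by omega)
    have d2 := hd 2 (by omega) (by omega)
    have d1 := hd 1 (by omega) (by omega)
    norm_num at d1 d2 d3
    obtain rfl | rfl | rfl : j = -1 ∨ j = 0 ∨ j = 1 := by omega
    · have d0 := hd 0 (by omega) (by omega)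
      have d00 := hd (-1) (by omega) (by omega)
      norm_num at d0 d00
      linarith
    · have d0 := hd 0 (by omega) (by omega)
      norm_num at d0
      linarith
    · linarith
  have hg := aux_geom p h0 hlc (4/5) (by norm_num) j 3 hjp (by omega) h43
  rcases n with _ | _ | _ | n
  · have := hle1 0
    norm_num; linarith
  · have := hle1 1
    norm_num; linarith
  · norm_num; linarith
  · have := hg n
    have e : ((n + 1 + 1 + 1 : ℕ) : ℤ) = 3 + n := by push_cast; ring
    rw [e]
    have : (0:ℝ) < (4/5)^n := by positivity
    have e2 : (4/5:ℝ)^(n+1+1+1) = (4/5)^n * (64/125) := by ring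
    rw [e2]
    nlinarith

theorem aux_tail_int (p : ℤ → ℝ) (h0 : ∀ k, 0 ≤ p k) (hlc : IsLogConcavePMF p)
    (hs : HasSum p 1) 
    (hv : (∑' k : ℤ, (k : ℝ) ^ 2 * p k) ≤ 1) (k : ℤ) :
    p k ≤ 5 / 4 * (4 / 5) ^ k.natAbs := by
  have hs2 := aux_summ p h0 hlc hs
  rcases le_total 0 k with h | h
  · have := aux_tail p h0 hlc hs hs2 hv k.natAbs
    rwa [Int.natAbs_of_nonneg h] at this
  · have e := aux_hs_neg _ _ hs2.hasSum
    have e' : HasSum (fun k : ℤ => (k:ℝ)^2 * p (-k)) (∑' k : ℤ, (k : ℝ) ^ 2 * p k) := by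
      convert e using 2; push_cast; ring
    have := aux_tail _ (fun k => h0 (-k)) (aux_neg p hlc) (aux_hs_neg p 1 hs) e'.summable
      (by rw [e'.tsum_eq]; exact hv) k.natAbs
    have e3 : -(k.natAbs : ℤ) = k := by omega
    simp only [e3] at this
    exact this

theorem aux_G : ∃ S : ℝ, S ≤ 1458 ∧
    HasSum (fun k : ℤ => 2 * ((k.natAbs + 2).choose 2 : ℝ) * (43/50) ^ k.natAbs) S := by
  have h := (hasSum_choose_mul_geometric_of_norm_lt_one (𝕜 := ℝ) 2 (r := 43/50)
    (by norm_num)).mul_left 2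
  have := HasSum.of_nat_of_neg
    (f := fun k : ℤ => 2 * ((k.natAbs + 2).choose 2 : ℝ) * (43/50) ^ k.natAbs)
    (by simpa [mul_assoc] using h) (by simpa [mul_assoc] using h)
  refine ⟨_, ?_, this⟩
  norm_num

theorem aux_sq_le (k : ℤ) : (k:ℝ)^2 ≤ 2 * ((k.natAbs + 2).choose 2 : ℝ) := by
  rw [Nat.cast_choose_two]
  have : (k:ℝ)^2 = (k.natAbs:ℝ)^2 := by
    rw [← sq_abs, Nat.cast_natAbs, Int.cast_abs]
  rw [this]
  push_cast
  have : (0:ℝ) ≤ k.natAbs := by positivity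
  nlinarith

theorem aux_point (a L lc P Q : ℝ) (k : ℤ) (ha : 0 < a) (hP0 : 0 ≤ P) (hP1 : P ≤ 1) (hQ0 : 0 ≤ Q)
    (hlc : 0 ≤ lc)
    (hPQ : 0 < P → 0 < Q) (hQ : 0 < Q → Real.log (1 / Q) ≤ a * (k:ℝ)^2 + lc)
    (ht : P ≤ 5 / 4 * (4 / 5) ^ k.natAbs) (hL : 0 ≤ L) :
    P * Real.log (P / Q) ≤ ((|P - Q| + (P - Q)) / 2) * (1 + lc + a * (256 * L^2)) +
      (a * Real.exp (-L) * (5/4)) * (2 * ((k.natAbs + 2).choose 2 : ℝ) * (43/50) ^ k.natAbs) := by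
  have hB : 0 ≤ (a * Real.exp (-L) * (5/4)) * (2 * ((k.natAbs + 2).choose 2 : ℝ) * (43/50) ^ k.natAbs) := by
    positivity
  rcases le_or_gt P Q with h | h
  · have h1 : (|P - Q| + (P - Q)) / 2 = 0 := by rw [abs_of_nonpos (by linarith)]; ring
    rw [h1]
    have : Real.log (P / Q) ≤ 0 := Real.log_nonpos (by positivity) (div_le_one_of_le₀ h hQ0)
    nlinarith
  · have hPp : 0 < P := by linarith
    have hQp := hPQ hPp
    have h1 : (|P - Q| + (P - Q)) / 2 = P - Q := by rw [abs_of_nonneg (by linarith)]; ring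
    rw [h1]
    have hlog1 : Q * Real.log (P/Q) ≤ P - Q := by
      have := Real.log_le_sub_one_of_pos (div_pos hPp hQp)
      have h2 := mul_le_mul_of_nonneg_left this hQ0
      have h3 : Q * (P / Q - 1) = P - Q := by field_simp
      linarith
    have hlog2 : Real.log (P/Q) ≤ a * (k:ℝ)^2 + lc :=
      (Real.log_le_log (by positivity) (by gcongr)).trans (hQ hQp)
    have hmain : P * Real.log (P/Q) ≤ (P - Q) * (1 + lc + a * (k:ℝ)^2) := by
      nlinarith
    suffices hk : (P - Q) * (a * (k:ℝ)^2) ≤ (P - Q) * (a * (256 * L^2)) + (a * Real.exp (-L) * (5/4)) * (2 * ((k.natAbs + 2).choose 2 : ℝ) * (43/50) ^ k.natAbs) by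
      nlinarith
    have hkk : (k:ℝ)^2 = (k.natAbs:ℝ)^2 := by
      rw [← sq_abs, Nat.cast_natAbs, Int.cast_abs]
    rcases le_or_gt (k.natAbs : ℝ) (16 * L) with hT | hT
    · have : (k:ℝ)^2 ≤ 256 * L^2 := by rw [hkk]; nlinarith [Nat.cast_nonneg (α := ℝ) k.natAbs]
      have : (P - Q) * (a * (k:ℝ)^2) ≤ (P - Q) * (a * (256 * L^2)) := by
        gcongr
      linarith
    · have he : (4/5:ℝ)^k.natAbs ≤ Real.exp (-L) * (43/50)^k.natAbs := by
        have e1 : (4/5:ℝ) ≤ Real.exp (-(1/16)) * (43/50) := by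
          have := Real.add_one_le_exp (-(1/16) : ℝ)
          linarith
        calc (4/5:ℝ)^k.natAbs ≤ (Real.exp (-(1/16)) * (43/50))^k.natAbs := by gcongr
          _ = Real.exp (k.natAbs * (-(1/16))) * (43/50)^k.natAbs := by
            rw [mul_pow, ← Real.exp_nat_mul]
          _ ≤ _ := by
            gcongr
            linarith
      have hb : P - Q ≤ 5/4 * (Real.exp (-L) * (43/50)^k.natAbs) := by linarith
      have hA : 0 ≤ (P - Q) * (a * (256 * L^2)) := by
        have : 0 ≤ P - Q := by linarith
        positivity
      have := aux_sq_le k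
      calc (P - Q) * (a * (k:ℝ)^2) ≤ (5/4 * (Real.exp (-L) * (43/50)^k.natAbs)) * (a * (2 * ((k.natAbs + 2).choose 2 : ℝ))) := by
            gcongr
        _ = (a * Real.exp (-L) * (5/4)) * (2 * ((k.natAbs + 2).choose 2 : ℝ) * (43/50) ^ k.natAbs) := by ring
        _ ≤ _ := by linarith

theorem aux_hasSum (μ : Measure ℤ) [IsProbabilityMeasure μ] (p : ℤ → ℝ)
    (hp : ∀ k : ℤ, p k = (μ {k}).toReal) : HasSum p 1 := by
  have h : ∑' k : ℤ, μ {k} = 1 := by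
    have := Measure.tsum_indicator_apply_singleton μ Set.univ MeasurableSet.univ
    simpa using this
  have h2 : p = fun k => (μ {k}).toReal := funext hp
  have h3 := ENNReal.hasSum_toReal (f := fun k : ℤ => μ {k}) (by rw [h]; simp)
  rw [h2]
  rwa [← ENNReal.tsum_toReal_eq (fun k => measure_ne_top μ _), h] at h3

/-- For `a > 0`, `c ≥ 2`, `ν` with p.m.f. `q ∈ Q(a,c)` and `μ` centered log-concave
with variance at most 1 and p.m.f. `p` supported in the support of `q`:
`D(μ‖ν) ≤ d_TV(μ,ν)·(288a·log²(√2(9 + log c + 51a)/d_TV(μ,ν)) + 2 log c + 1)`. -/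
theorem KL_le_dTV_isotropic
    (a c : ℝ) (ha : 0 < a) (hc : 2 ≤ c)
    (μ ν : Measure ℤ) [IsProbabilityMeasure μ] [IsProbabilityMeasure ν]
    (p q : ℤ → ℝ)
    (hp : ∀ k : ℤ, p k = (μ {k}).toReal) (hq : ∀ k : ℤ, q k = (ν {k}).toReal)
    (hqQ : MemQClass a c q)
    (hlc : IsLogConcavePMF p)
    (hcent : (∑' k : ℤ, (k : ℝ) * p k) = 0)
    (hvar : (∑' k : ℤ, (k : ℝ) ^ 2 * p k) ≤ 1)
    (hsupp : ∀ k : ℤ, 0 < p k → 0 < q k) :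
    KLdiv p q ≤ dTV p q *
      (288 * a * (Real.log (Real.sqrt 2 * (9 + Real.log c + 51 * a) / dTV p q)) ^ 2 +
        2 * Real.log c + 1) := by
  have hsp := aux_hasSum μ p hp
  have hsq := aux_hasSum ν q hq
  have hp0 : ∀ k, 0 ≤ p k := fun k => by rw [hp]; exact ENNReal.toReal_nonneg
  have hp1 : ∀ k, p k ≤ 1 := fun k => le_hasSum hsp k (fun j _ => hp0 j)
  have hsub : HasSum (fun k => p k - q k) (1 - 1) := hsp.sub hsq
  have habs : Summable (fun k => |p k - q k|) := hsub.summable.abs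
  have hd : HasSum (fun k => |p k - q k|) (dTV p q) := habs.hasSum
  have hd0 : 0 ≤ dTV p q := hd.nonneg (fun k => abs_nonneg _)
  have hd2 : dTV p q ≤ 2 := by
    have := hasSum_le (fun k => (abs_sub (p k) (q k)).trans_eq
      (by rw [abs_of_nonneg (hp0 k), abs_of_nonneg (hqQ.1 k).1])) hd (hsp.add hsq)
    linarith
  have hlogc : 0 ≤ Real.log c := Real.log_nonneg (by linarith)
  rcases hd0.eq_or_lt with hz | hpos
  · have hpq : ∀ k, p k = q k := by
      intro k
      have := le_hasSum hd k (fun j _ => abs_nonneg _)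
      rw [← hz] at this
      have := abs_nonpos_iff.mp this
      linarith
    have : KLdiv p q = 0 := by
      unfold KLdiv
      convert tsum_zero with k
      rw [hpq k]
      rcases eq_or_ne (q k) 0 with h | h
      · simp [h]
      · rw [div_self h]; simp
    rw [this, ← hz]; simp
  set δ := dTV p q with hδ
  set A := Real.sqrt 2 * (9 + Real.log c + 51 * a) with hA
  have hs2 : (4/3:ℝ) ≤ Real.sqrt 2 := Real.le_sqrt_of_sq_le (by norm_num)
  have hA12 : 12 ≤ A := by rw [hA]; nlinarith
  have hAp : 0 < A := by linarith
  set L := Real.log (A / δ) with hL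
  have hL1 : 1 ≤ L := by
    rw [hL, Real.le_log_iff_exp_le (by positivity), le_div_iff₀ hpos]
    have := Real.exp_one_lt_d9
    nlinarith
  have hexp : Real.exp (-L) = δ / A := by
    rw [Real.exp_neg, hL, Real.exp_log (by positivity), inv_div]
  obtain ⟨S, hS, hG⟩ := aux_G
  have hrhs := (((hd.add hsub).div_const 2).mul_right (1 + Real.log c + a * (256 * L^2))).add
    (hG.mul_left (a * Real.exp (-L) * (5/4)))
  have hpt : ∀ k, p k * Real.log (p k / q k) ≤ _ := fun k =>
    aux_point a L (Real.log c) (p k) (q k) k ha (hp0 k) (hp1 k) (hqQ.1 k).1 hlogc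
      (hsupp k) (hqQ.2 k) (aux_tail_int p hp0 hlc hsp hvar k) (by linarith)
  have hfin : (δ + (1 - 1)) / 2 * (1 + Real.log c + a * (256 * L^2)) + a * Real.exp (-L) * (5/4) * S
      ≤ δ * (288 * a * L^2 + 2 * Real.log c + 1) := by
    have h1 : a * Real.exp (-L) * (5/4) * S ≤ a * (δ / 12) * (5/4) * 1458 := by
      rw [hexp]
      have hS0 : 0 ≤ S := hG.nonneg (fun k => by positivity)
      gcongr
    have h2 : a * δ ≤ a * δ * L^2 := le_mul_of_one_le_right (by positivity) (by nlinarith)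
    have h3 : 0 ≤ δ * Real.log c := by positivity
    nlinarith
  by_cases hsum : Summable (fun k => p k * Real.log (p k / q k))
  · exact (hasSum_le hpt hsum.hasSum hrhs).trans hfin
  · unfold KLdiv
    rw [tsum_eq_zero_of_not_summable hsum]
    positivity
end
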